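/- Let n ≥ 3 be an integer and assume θ_n ∈ [α_n, γ_n) satisfies F(θ_n) = 0. For θ ∈ [θ_n, β_n] and either choice of sign, set s = x_±² + y² + z_±² - x_± * y * z_± - 4 with y = 2cos θ. Then s > 0 for every θ ∈ (θ_n, β_n], and s = 0 at θ = θ_n. -/

import Mathlib

open Real

/-- The left endpoint `α_n` of the interval considered for the `(-2,3,2n+1)`-pretzel knot. -/
noncomputable def alphaN (n : ℕ) : ℝ :=
  if n % 3 = 0 then 2 * π / 3 - π / (6 * (n : ℝ) + 15)
  else if n % 3 = 1 then 2 * π / 3 + π / (6 * (n : ℝ) - 3)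
  else 2 * π / 3 - π / (2 * (n : ℝ) + 5)

/-- The right endpoint `β_n` of the interval considered for the `(-2,3,2n+1)`-pretzel knot. -/
noncomputable def betaN (n : ℕ) : ℝ :=
  if n % 3 = 0 then 2 * π / 3 + π / (6 * (n : ℝ) + 3)
  else if n % 3 = 1 then 2 * π / 3 + π / (2 * (n : ℝ) + 1)
  else 2 * π / 3 - π / (6 * (n : ℝ) + 3)

/-- The interior point `γ_n ∈ (α_n, β_n)`. -/
noncomputable def gammaN (n : ℕ) : ℝ :=
  if n % 3 = 0 then 2 * π / 3
  else if n % 3 = 1 then 2 * π / 3 + 4 * π / (12 * (n : ℝ) + 9)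
  else 2 * π / 3 - 4 * π / (12 * (n : ℝ) + 9)

/-- `F θ = 2 cos ((n+1)θ) cos (3θ/2) - cos ((2n+1)θ/2)`. -/
noncomputable def FN (n : ℕ) (θ : ℝ) : ℝ :=
  2 * Real.cos (((n : ℝ) + 1) * θ) * Real.cos (3 * θ / 2)
    - Real.cos ((2 * (n : ℝ) + 1) * θ / 2)

/-- `r = (S (n-2) y ∓ √(S (n-2) y ^ 2 + 4)) / 2`, with the `-` sign iff `n ≡ 0 (mod 3)`. -/
noncomputable def rD (S : ℤ → ℝ → ℝ) (n : ℕ) (y : ℝ) : ℝ :=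
  if n % 3 = 0 then (S ((n : ℤ) - 2) y - Real.sqrt (S ((n : ℤ) - 2) y ^ 2 + 4)) / 2
  else (S ((n : ℤ) - 2) y + Real.sqrt (S ((n : ℤ) - 2) y ^ 2 + 4)) / 2

/-- `z_ε = ε * √(1 + r (S (n-2) y - S (n-3) y))`, where `ε = ±1` selects `z_±`. -/
noncomputable def zD (S : ℤ → ℝ → ℝ) (n : ℕ) (ε y : ℝ) : ℝ :=
  ε * Real.sqrt (1 + rD S n y * (S ((n : ℤ) - 2) y - S ((n : ℤ) - 3) y))

/-- `x_ε = z_ε * (y + 1 - (S (n-3) y + r)/S (n-2) y)`, where `ε = ±1` selects `x_±`. -/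
noncomputable def xD (S : ℤ → ℝ → ℝ) (n : ℕ) (ε y : ℝ) : ℝ :=
  zD S n ε y * (y + 1 - (S ((n : ℤ) - 3) y + rD S n y) / S ((n : ℤ) - 2) y)


/-- The Chebyshev polynomials of the second kind at `2 cos θ`, in trigonometric form. -/
theorem chebyshev_mul_sin {S : ℤ → ℝ → ℝ} (hS0 : ∀ y : ℝ, S 0 y = 1) (hS1 : ∀ y : ℝ, S 1 y = y)
    (hSrec : ∀ (k : ℤ) (y : ℝ), S k y = y * S (k - 1) y - S (k - 2) y) (θ : ℝ) (m : ℕ) :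
    S m (2 * cos θ) * sin θ = sin (((m : ℝ) + 1) * θ) ∧
      S (m + 1) (2 * cos θ) * sin θ = sin (((m : ℝ) + 2) * θ) := by
  induction m with
  | zero =>
    simp only [Nat.cast_zero, zero_add, hS0, hS1, one_mul, sin_two_mul, true_and]
    ring
  | succ m ih =>
    obtain ⟨h₀, h₁⟩ := ih
    have hrec := hSrec (m + 2) (2 * cos θ)
    rw [show (m : ℤ) + 2 - 1 = m + 1 by ring, show (m : ℤ) + 2 - 2 = m by ring] at hrec
    push_cast
    rw [show (m : ℝ) + 1 + 1 = m + 2 by ring, show (m : ℤ) + 1 + 1 = m + 2 by ring]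
    refine ⟨h₁, ?_⟩
    have e₀ : ((m : ℝ) + 1) * θ = (m + 2) * θ - θ := by ring
    have e₁ : ((m : ℝ) + 1 + 2) * θ = (m + 2) * θ + θ := by ring
    rw [e₀, sin_sub] at h₀
    rw [e₁, sin_add, hrec]
    linear_combination 2 * cos θ * h₁ - h₀

/-- Consecutive Chebyshev polynomials satisfy `S_{m+1}² + S_m² - y S_{m+1} S_m = 1`. -/
theorem chebyshev_quadratic {S : ℤ → ℝ → ℝ} (hS0 : ∀ y : ℝ, S 0 y = 1) (hS1 : ∀ y : ℝ, S 1 y = y)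
    (hSrec : ∀ (k : ℤ) (y : ℝ), S k y = y * S (k - 1) y - S (k - 2) y) (y : ℝ) (m : ℕ) :
    S (m + 1) y ^ 2 + S m y ^ 2 - y * S (m + 1) y * S m y = 1 := by
  induction m with
  | zero =>
    simp only [Nat.cast_zero, zero_add, hS0, hS1]
    ring
  | succ m ih =>
    have hrec := hSrec (m + 2) y
    rw [show (m : ℤ) + 2 - 1 = m + 1 by ring, show (m : ℤ) + 2 - 2 = m by ring] at hrec
    push_cast
    rw [show (m : ℤ) + 1 + 1 = m + 2 by ring, hrec]
    linear_combination ih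

theorem FN_eq_add_sub (n : ℕ) (θ : ℝ) :
    FN n θ = cos (((n : ℝ) + 5 / 2) * θ) + cos (((n : ℝ) - 1 / 2) * θ)
      - cos (((n : ℝ) + 1 / 2) * θ) := by
  have e₁ : ((n : ℝ) + 5 / 2) * θ = (n + 1) * θ + 3 * θ / 2 := by ring
  have e₂ : ((n : ℝ) - 1 / 2) * θ = (n + 1) * θ - 3 * θ / 2 := by ring
  have e₃ : ((n : ℝ) + 1 / 2) * θ = (2 * n + 1) * θ / 2 := by ring
  rw [FN, e₁, e₂, e₃, cos_add, cos_sub]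
  ring

/-- The combination of `S_{n-2}` and `S_{n-3}` controlling the sign of `s`, in terms of `FN`. -/
theorem two_mul_sin_mul_FN (n : ℕ) (θ : ℝ) :
    2 * sin (θ / 2) * FN n θ =
      ((2 * cos θ) ^ 4 - (2 * cos θ) ^ 3 - 4 * (2 * cos θ) ^ 2 + 4 * (2 * cos θ) + 1)
          * sin (((n : ℝ) - 1) * θ)
        + (1 - 2 * cos θ) * ((2 * cos θ) ^ 2 - 3) * sin (((n : ℝ) - 2) * θ) := by
  obtain ⟨h, rfl⟩ : ∃ h, θ = 2 * h := ⟨θ / 2, by ring⟩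
  have e₁ : ((n : ℝ) - 1) * (2 * h) = n * (2 * h) - 2 * h := by ring
  have e₂ : ((n : ℝ) - 2) * (2 * h) = n * (2 * h) - 2 * (2 * h) := by ring
  have e₃ : ((n : ℝ) + 1) * (2 * h) = n * (2 * h) + 2 * h := by ring
  have e₄ : (2 * (n : ℝ) + 1) * (2 * h) / 2 = n * (2 * h) + h := by ring
  have e₅ : 3 * (2 * h) / 2 = 3 * h := by ring
  have e₆ : 2 * h / 2 = h := by ring
  rw [FN, e₁, e₂, e₃, e₄, e₅, e₆]
  generalize (n : ℝ) * (2 * h) = φ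
  simp only [cos_add, sin_sub, cos_two_mul (2 * h), sin_two_mul (2 * h), cos_three_mul]
  rw [sin_two_mul, cos_two_mul]
  have hs := sin_sq_add_cos_sq h
  generalize sin h = s at *
  generalize cos h = c at *
  generalize sin φ = A
  generalize cos φ = B
  grind

/-- The sign of `s` when `S_{n-2} > 0`; here `a = S_{n-2}`, `b = S_{n-3}`, and `z ^ 2` is replaced
by its value. -/
theorem sign_of_pos {a b y r : ℝ} (ha : 0 < a) (hr : 0 < r) (hra : r ^ 2 = a * r + 1)
    (hy : y < 1) (hab : a ^ 2 + b ^ 2 - y * a * b = 1) :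
    ((y ^ 4 - y ^ 3 - 4 * y ^ 2 + 4 * y + 1) * a + (1 - y) * (y ^ 2 - 3) * b < 0 →
      0 < (1 + r * (a - b)) * ((y + 1 - (b + r) / a) ^ 2 + 1 - (y + 1 - (b + r) / a) * y)
        + y ^ 2 - 4) ∧
    ((y ^ 4 - y ^ 3 - 4 * y ^ 2 + 4 * y + 1) * a + (1 - y) * (y ^ 2 - 3) * b = 0 →
      y ^ 2 ≤ 2 → b ≤ 0 →
      (1 + r * (a - b)) * ((y + 1 - (b + r) / a) ^ 2 + 1 - (y + 1 - (b + r) / a) * y)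
        + y ^ 2 - 4 = 0) := by
  have hs : (1 + r * (a - b)) * ((y + 1 - (b + r) / a) ^ 2 + 1 - (y + 1 - (b + r) / a) * y)
        + y ^ 2 - 4 = ((1 - y) * r - ((2 - y ^ 2) * a - (1 - y) * b)) / a := by
    field_simp
    grind
  rw [hs]
  have hy' : 0 < 1 - y := by linarith
  set G := (y ^ 4 - y ^ 3 - 4 * y ^ 2 + 4 * y + 1) * a + (1 - y) * (y ^ 2 - 3) * b with hG
  set Q := (2 - y ^ 2) * a - (1 - y) * b with hQ
  -- `Q / (1 - y)` is compared with the positive root `r` of `X ^ 2 - a X - 1`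
  have key : (Q - (1 - y) * r) * (r * Q + (1 - y)) = r * (a * G) := by
    rw [hQ, hG]
    grind
  refine ⟨fun hlt => div_pos ?_ ha, fun heq hy2 hb => ?_⟩
  · by_contra! hle
    have hQr : (1 - y) * r ≤ Q := by linarith
    have hQ0 : 0 ≤ Q := (mul_pos hy' hr).le.trans hQr
    have h₁ : 0 ≤ (Q - (1 - y) * r) * (r * Q + (1 - y)) :=
      mul_nonneg (by linarith) (by positivity)
    have h₂ : r * (a * G) < 0 := mul_neg_of_pos_of_neg hr (mul_neg_of_pos_of_neg ha hlt)
    linarith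
  · have hQ0 : 0 ≤ Q := by
      have h₁ : 0 ≤ (2 - y ^ 2) * a := mul_nonneg (by linarith) ha.le
      have h₂ : (1 - y) * b ≤ 0 := mul_nonpos_of_nonneg_of_nonpos hy'.le hb
      linarith
    rw [heq, mul_zero, mul_zero] at key
    have h₁ : r * Q + (1 - y) ≠ 0 := by positivity
    have h₂ := (mul_eq_zero.mp key).resolve_right h₁
    rw [show (1 - y) * r - Q = 0 by linarith, zero_div]

/-- The sign of `s` in terms of the sign `σ` shared by `S_{n-2}` and `r`, and of `FN`. -/
theorem sign_of_FN {S : ℤ → ℝ → ℝ} (hS0 : ∀ y : ℝ, S 0 y = 1) (hS1 : ∀ y : ℝ, S 1 y = y)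
    (hSrec : ∀ (k : ℤ) (y : ℝ), S k y = y * S (k - 1) y - S (k - 2) y)
    {n : ℕ} (hn : 3 ≤ n) {ε : ℝ} (hε : ε = 1 ∨ ε = -1) {σ : ℝ}
    (hσ : n % 3 = 0 ∧ σ = -1 ∨ n % 3 ≠ 0 ∧ σ = 1) {θ : ℝ} (h₀ : π / 2 ≤ θ) (h₁ : θ < π)
    (ha : 0 < σ * sin (((n : ℝ) - 1) * θ)) (hb : σ * sin (((n : ℝ) - 2) * θ) ≤ 0) :
    (σ * FN n θ < 0 → 0 < xD S n ε (2 * cos θ) ^ 2 + (2 * cos θ) ^ 2 + zD S n ε (2 * cos θ) ^ 2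
      - xD S n ε (2 * cos θ) * (2 * cos θ) * zD S n ε (2 * cos θ) - 4) ∧
    (FN n θ = 0 → θ ≤ 3 * π / 4 → xD S n ε (2 * cos θ) ^ 2 + (2 * cos θ) ^ 2
      + zD S n ε (2 * cos θ) ^ 2
      - xD S n ε (2 * cos θ) * (2 * cos θ) * zD S n ε (2 * cos θ) - 4 = 0) := by
  have hπ := pi_pos
  have hsin : 0 < sin θ := sin_pos_of_pos_of_lt_pi (by linarith) h₁
  have hsin' : 0 < sin (θ / 2) := sin_pos_of_pos_of_lt_pi (by linarith) (by linarith)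
  have hcos : cos θ ≤ 0 := cos_nonpos_of_pi_div_two_le_of_le h₀ (by linarith)
  have hF := two_mul_sin_mul_FN n θ
  have hy2 : θ ≤ 3 * π / 4 → (2 * cos θ) ^ 2 ≤ 2 := by
    intro h
    have h₂ : cos (2 * θ) ≤ 0 := cos_nonpos_of_pi_div_two_le_of_le (by linarith) (by linarith)
    rw [cos_two_mul] at h₂
    linarith
  obtain ⟨m, rfl⟩ : ∃ m, n = m + 3 := ⟨n - 3, by omega⟩
  have hab := chebyshev_quadratic hS0 hS1 hSrec (2 * cos θ) m
  obtain ⟨hb', ha'⟩ := chebyshev_mul_sin hS0 hS1 hSrec θ m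
  rw [show ((m + 3 : ℕ) : ℝ) - 1 = m + 2 by push_cast; ring, ← ha'] at ha hF
  rw [show ((m + 3 : ℕ) : ℝ) - 2 = m + 1 by push_cast; ring, ← hb'] at hb hF
  simp only [xD, zD, rD]
  rw [show ((m + 3 : ℕ) : ℤ) - 2 = m + 1 by push_cast; ring,
    show ((m + 3 : ℕ) : ℤ) - 3 = m by push_cast; ring]
  have hy1 : 2 * cos θ < 1 := by linarith
  generalize S (m + 1) (2 * cos θ) = a at *
  generalize S m (2 * cos θ) = b at *
  generalize 2 * cos θ = y at *
  have hsq : √(a ^ 2 + 4) ^ 2 = a ^ 2 + 4 := sq_sqrt (by positivity)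
  have hlt : |a| < √(a ^ 2 + 4) := by
    rw [← sqrt_sq_eq_abs]
    exact sqrt_lt_sqrt (by positivity) (by linarith)
  obtain ⟨hlt₁, hlt₂⟩ := abs_lt.mp hlt
  have hr : ∃ r, (if (m + 3) % 3 = 0 then (a - √(a ^ 2 + 4)) / 2 else (a + √(a ^ 2 + 4)) / 2) = r ∧
      r ^ 2 = a * r + 1 ∧ 0 < σ * r := by
    refine ⟨_, rfl, ?_⟩
    rcases hσ with ⟨h, rfl⟩ | ⟨h, rfl⟩
    · rw [if_pos h]
      constructor <;> linarith
    · rw [if_neg h]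
      constructor <;> linarith
  obtain ⟨r, hr, hra, hσr⟩ := hr
  rw [hr]
  have hσ2 : σ ^ 2 = 1 := by rcases hσ with ⟨-, rfl⟩ | ⟨-, rfl⟩ <;> norm_num
  have hε2 : ε ^ 2 = 1 := by rcases hε with rfl | rfl <;> norm_num
  rw [← mul_assoc] at ha hb
  have hσa : 0 < σ * a := pos_of_mul_pos_left ha hsin.le
  have hσb : σ * b ≤ 0 := nonpos_of_mul_nonpos_left hb hsin
  have hz : 0 ≤ 1 + r * (a - b) := by
    have h : 0 ≤ (σ * r) * (σ * a - σ * b) := mul_nonneg hσr.le (by linarith)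
    linear_combination h + r * (a - b) * hσ2
  have hdiv : (σ * b + σ * r) / (σ * a) = (b + r) / a := by
    rw [← mul_add, mul_div_mul_left _ _ (left_ne_zero_of_mul hσa.ne')]
  have hmul : 1 + σ * r * (σ * a - σ * b) = 1 + r * (a - b) := by
    linear_combination r * (a - b) * hσ2
  have main := sign_of_pos (b := σ * b) (y := y) hσa hσr (by linear_combination σ ^ 2 * hra + hσ2)
    hy1 (by linear_combination σ ^ 2 * hab + hσ2)
  rw [hdiv, hmul] at main
  generalize y + 1 - (b + r) / a = c at *
  have hs : (ε * √(1 + r * (a - b)) * c) ^ 2 + y ^ 2 + (ε * √(1 + r * (a - b))) ^ 2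
      - ε * √(1 + r * (a - b)) * c * y * (ε * √(1 + r * (a - b))) - 4
      = (1 + r * (a - b)) * (c ^ 2 + 1 - c * y) + y ^ 2 - 4 := by
    linear_combination (c ^ 2 + 1 - c * y) * (ε ^ 2 * sq_sqrt hz + (1 + r * (a - b)) * hε2)
  rw [hs]
  have hFσ : (y ^ 4 - y ^ 3 - 4 * y ^ 2 + 4 * y + 1) * (σ * a) + (1 - y) * (y ^ 2 - 3) * (σ * b)
      = 2 * sin (θ / 2) * (σ * FN (m + 3) θ) / sin θ := by
    rw [eq_div_iff hsin.ne']
    linear_combination -σ * hF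
  rw [hFσ] at main
  refine ⟨fun h => main.1 (div_neg_of_neg_of_pos (mul_neg_of_pos_of_neg (by positivity) h) hsin),
    fun h h' => main.2 (by rw [h]; simp) (hy2 h') hσb⟩

/-- The conclusion on an interval `[θn, β]` follows from sign conditions, written in terms of
`θ - 2π/3`. -/
theorem s_sign_of_interval {S : ℤ → ℝ → ℝ} (hS0 : ∀ y : ℝ, S 0 y = 1) (hS1 : ∀ y : ℝ, S 1 y = y)
    (hSrec : ∀ (k : ℤ) (y : ℝ), S k y = y * S (k - 1) y - S (k - 2) y)
    {n : ℕ} (hn : 3 ≤ n) {ε : ℝ} (hε : ε = 1 ∨ ε = -1) {σ : ℝ}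
    (hσ : n % 3 = 0 ∧ σ = -1 ∨ n % 3 ≠ 0 ∧ σ = 1) {θn β : ℝ} (hθnβ : θn ≤ β)
    (hFθn : FN n θn = 0) (h₀ : π / 2 ≤ θn) (h₁ : θn ≤ 3 * π / 4) (hβ : β < π)
    (hab : ∀ δ ∈ Set.Icc (θn - 2 * π / 3) (β - 2 * π / 3),
      0 < σ * sin (((n : ℝ) - 1) * (2 * π / 3 + δ)) ∧
      σ * sin (((n : ℝ) - 2) * (2 * π / 3 + δ)) ≤ 0)
    (hF : ∀ δ ∈ Set.Ioc (θn - 2 * π / 3) (β - 2 * π / 3), σ * FN n (2 * π / 3 + δ) < 0) :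
    (∀ θ ∈ Set.Ioc θn β,
      0 < xD S n ε (2 * cos θ) ^ 2 + (2 * cos θ) ^ 2 + zD S n ε (2 * cos θ) ^ 2
          - xD S n ε (2 * cos θ) * (2 * cos θ) * zD S n ε (2 * cos θ) - 4) ∧
    (xD S n ε (2 * cos θn) ^ 2 + (2 * cos θn) ^ 2 + zD S n ε (2 * cos θn) ^ 2
        - xD S n ε (2 * cos θn) * (2 * cos θn) * zD S n ε (2 * cos θn) - 4 = 0) := by
  have hab' : ∀ θ ∈ Set.Icc θn β,
      0 < σ * sin (((n : ℝ) - 1) * θ) ∧ σ * sin (((n : ℝ) - 2) * θ) ≤ 0 := by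
    intro θ hθ
    have h := hab (θ - 2 * π / 3) ⟨by linarith [hθ.1], by linarith [hθ.2]⟩
    rwa [add_sub_cancel] at h
  refine ⟨fun θ hθ => ?_, ?_⟩
  · obtain ⟨ha, hb⟩ := hab' θ (Set.Ioc_subset_Icc_self hθ)
    have h := hF (θ - 2 * π / 3) ⟨by linarith [hθ.1], by linarith [hθ.2]⟩
    rw [add_sub_cancel] at h
    exact (sign_of_FN hS0 hS1 hSrec hn hε hσ (h₀.trans hθ.1.le) (hθ.2.trans_lt hβ) ha hb).1 h
  · obtain ⟨ha, hb⟩ := hab' θn (Set.left_mem_Icc.mpr hθnβ)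
    exact (sign_of_FN hS0 hS1 hSrec hn hε hσ h₀ (hθnβ.trans_lt hβ) ha hb).2 hFθn h₁

/-- Signs on the interval for `n ≡ 0 (mod 3)`. -/
theorem signs_of_mod_three_eq_zero {n : ℕ} (hn : 3 ≤ n) (h3 : n % 3 = 0) {δ₀ β : ℝ}
    (h₀ : -(π / (6 * n + 15)) ≤ δ₀) (hβ : β ≤ π / (6 * n + 3))
    (hF₀ : FN n (2 * π / 3 + δ₀) = 0) :
    (∀ δ ∈ Set.Icc δ₀ β, sin (((n : ℝ) - 1) * (2 * π / 3 + δ)) < 0 ∧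
      0 ≤ sin (((n : ℝ) - 2) * (2 * π / 3 + δ))) ∧
    ∀ δ ∈ Set.Ioc δ₀ β, 0 < FN n (2 * π / 3 + δ) := by
  have hπ := pi_pos
  have hn' : (3 : ℝ) ≤ n := by exact_mod_cast hn
  obtain ⟨k, hk⟩ : ∃ k : ℕ, (n : ℝ) = 3 * k := ⟨n / 3, by exact_mod_cast (by omega)⟩
  have bounds : ∀ δ ∈ Set.Icc δ₀ β, -π ≤ 6 * (n * δ) + 15 * δ ∧ 6 * (n * δ) + 3 * δ ≤ π ∧
      -π ≤ 33 * δ ∧ 21 * δ ≤ π := by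
    rintro δ ⟨hδ₀, hδ₁⟩
    have h₁ : -(π / (6 * n + 15)) ≤ δ := h₀.trans hδ₀
    have h₂ : δ ≤ π / (6 * n + 3) := hδ₁.trans hβ
    have h₃ : π / (6 * n + 15) ≤ π / 33 := by gcongr; linarith
    have h₄ : π / (6 * n + 3) ≤ π / 21 := by gcongr; linarith
    have h₅ : -(π / 33) ≤ δ ∧ δ ≤ π / 21 := ⟨by linarith, by linarith⟩
    rw [← neg_div, div_le_iff₀ (by positivity)] at h₁
    rw [le_div_iff₀ (by positivity)] at h₂
    refine ⟨?_, ?_, ?_, ?_⟩ <;> linarith [h₅.1, h₅.2]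
  have hF : ∀ δ, FN n (2 * π / 3 + δ) = cos (π / 3 - (n + 5 / 2) * δ)
      + cos (π / 3 - (n - 1 / 2) * δ) - cos (π / 3 + (n + 1 / 2) * δ) := by
    intro δ
    have e₁ : ((n : ℝ) + 5 / 2) * (2 * π / 3 + δ)
        = -(π / 3 - (n + 5 / 2) * δ) + (k + 1 : ℕ) * (2 * π) := by
      push_cast; linear_combination 2 * π / 3 * hk
    have e₂ : ((n : ℝ) - 1 / 2) * (2 * π / 3 + δ)
        = -(π / 3 - (n - 1 / 2) * δ) + k * (2 * π) := by
      linear_combination 2 * π / 3 * hk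
    have e₃ : ((n : ℝ) + 1 / 2) * (2 * π / 3 + δ)
        = π / 3 + (n + 1 / 2) * δ + k * (2 * π) := by
      linear_combination 2 * π / 3 * hk
    rw [FN_eq_add_sub, e₁, e₂, e₃]
    simp only [cos_add_nat_mul_two_pi, cos_neg]
  refine ⟨fun δ hδ => ?_, fun δ hδ => ?_⟩
  · obtain ⟨b₁, b₂, b₃, b₄⟩ := bounds δ hδ
    have e₁ : ((n : ℝ) - 1) * (2 * π / 3 + δ)
        = -(2 * π / 3 - (n - 1) * δ) + k * (2 * π) := by
      linear_combination 2 * π / 3 * hk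
    have e₂ : ((n : ℝ) - 2) * (2 * π / 3 + δ)
        = 2 * π / 3 + (n - 2) * δ + (k - 1 : ℤ) * (2 * π) := by
      push_cast; linear_combination 2 * π / 3 * hk
    have hlt : 2 * π / 3 - (n - 1) * δ < π := by
      rcases le_total 0 δ with h | h
      · linarith [mul_nonneg (by linarith : (0 : ℝ) ≤ n - 1) h]
      · linarith
    rw [e₁, e₂, sin_add_nat_mul_two_pi, sin_add_int_mul_two_pi, sin_neg, neg_lt_zero]
    exact ⟨sin_pos_of_pos_of_lt_pi (by linarith) hlt,
      sin_nonneg_of_nonneg_of_le_pi (by linarith) (by linarith)⟩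
  · obtain ⟨a₁, a₂, a₃, a₄⟩ := bounds δ₀ ⟨le_rfl, (hδ.1.trans_le hδ.2).le⟩
    obtain ⟨b₁, b₂, b₃, b₄⟩ := bounds δ (Set.Ioc_subset_Icc_self hδ)
    have hnδ : 0 ≤ ((n : ℝ) - 3) * (δ - δ₀) :=
      mul_nonneg (by linarith) (by linarith [hδ.1])
    have hlt := hδ.1
    rw [← hF₀, hF, hF]
    have c₁ : cos (π / 3 - (n + 5 / 2) * δ₀) < cos (π / 3 - (n + 5 / 2) * δ) :=
      cos_lt_cos_of_nonneg_of_le_pi (by linarith) (by linarith) (by linarith)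
    have c₂ : cos (π / 3 - (n - 1 / 2) * δ₀) < cos (π / 3 - (n - 1 / 2) * δ) :=
      cos_lt_cos_of_nonneg_of_le_pi (by linarith) (by linarith) (by linarith)
    have c₃ : cos (π / 3 + (n + 1 / 2) * δ) < cos (π / 3 + (n + 1 / 2) * δ₀) :=
      cos_lt_cos_of_nonneg_of_le_pi (by linarith) (by linarith) (by linarith)
    linarith

/-- Signs on the interval for `n ≡ 1 (mod 3)`. -/
theorem signs_of_mod_three_eq_one {n : ℕ} (hn : 4 ≤ n) (h3 : n % 3 = 1) {δ₀ β : ℝ}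
    (h₀ : π / (6 * n - 3) ≤ δ₀) (hβ : β ≤ π / (2 * n + 1))
    (hF₀ : FN n (2 * π / 3 + δ₀) = 0) :
    (∀ δ ∈ Set.Icc δ₀ β, 0 < sin (((n : ℝ) - 1) * (2 * π / 3 + δ)) ∧
      sin (((n : ℝ) - 2) * (2 * π / 3 + δ)) ≤ 0) ∧
    ∀ δ ∈ Set.Ioc δ₀ β, FN n (2 * π / 3 + δ) < 0 := by
  have hπ := pi_pos
  have hn' : (4 : ℝ) ≤ n := by exact_mod_cast hn
  obtain ⟨k, hk⟩ : ∃ k : ℕ, (n : ℝ) = 3 * k + 1 := ⟨n / 3, by exact_mod_cast (by omega)⟩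
  have bounds : ∀ δ ∈ Set.Icc δ₀ β, π ≤ 6 * (n * δ) - 3 * δ ∧ 2 * (n * δ) + δ ≤ π ∧
      0 < δ ∧ 9 * δ ≤ π ∧ 4 * δ ≤ n * δ := by
    rintro δ ⟨hδ₀, hδ₁⟩
    have hpos : (0 : ℝ) < 6 * n - 3 := by linarith
    have h₁ : π / (6 * n - 3) ≤ δ := h₀.trans hδ₀
    have h₂ : δ ≤ π / (2 * n + 1) := hδ₁.trans hβ
    have h₃ : π / (2 * n + 1) ≤ π / 9 := by gcongr; linarith
    have h₄ : 0 < δ := (div_pos hπ hpos).trans_le h₁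
    have h₅ := h₂
    rw [div_le_iff₀ hpos] at h₁
    rw [le_div_iff₀ (by positivity)] at h₂
    exact ⟨by linarith, by linarith, h₄, by linarith, by gcongr⟩
  have hF : ∀ δ, FN n (2 * π / 3 + δ) = cos (π / 3 + (n + 5 / 2) * δ)
      + cos (π / 3 + (n - 1 / 2) * δ) + cos ((n + 1 / 2) * δ) := by
    intro δ
    have e₁ : ((n : ℝ) + 5 / 2) * (2 * π / 3 + δ)
        = π / 3 + (n + 5 / 2) * δ + (k + 1 : ℕ) * (2 * π) := by
      push_cast; linear_combination 2 * π / 3 * hk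
    have e₂ : ((n : ℝ) - 1 / 2) * (2 * π / 3 + δ)
        = π / 3 + (n - 1 / 2) * δ + k * (2 * π) := by
      linear_combination 2 * π / 3 * hk
    have e₃ : ((n : ℝ) + 1 / 2) * (2 * π / 3 + δ)
        = (n + 1 / 2) * δ + π + k * (2 * π) := by
      linear_combination 2 * π / 3 * hk
    rw [FN_eq_add_sub, e₁, e₂, e₃]
    simp only [cos_add_nat_mul_two_pi, cos_add_pi, sub_neg_eq_add]
  refine ⟨fun δ hδ => ?_, fun δ hδ => ?_⟩
  · obtain ⟨b₁, b₂, b₃, b₄, b₅⟩ := bounds δ hδ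
    have e₁ : ((n : ℝ) - 1) * (2 * π / 3 + δ) = (n - 1) * δ + k * (2 * π) := by
      linear_combination 2 * π / 3 * hk
    have e₂ : ((n : ℝ) - 2) * (2 * π / 3 + δ)
        = -(2 * π / 3 - (n - 2) * δ) + k * (2 * π) := by
      linear_combination 2 * π / 3 * hk
    rw [e₁, e₂, sin_add_nat_mul_two_pi, sin_add_nat_mul_two_pi, sin_neg, neg_nonpos]
    exact ⟨sin_pos_of_pos_of_lt_pi (by linarith) (by linarith),
      sin_nonneg_of_nonneg_of_le_pi (by linarith) (by linarith)⟩
  · obtain ⟨a₁, a₂, a₃, a₄, a₅⟩ := bounds δ₀ ⟨le_rfl, (hδ.1.trans_le hδ.2).le⟩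
    obtain ⟨b₁, b₂, b₃, b₄, b₅⟩ := bounds δ (Set.Ioc_subset_Icc_self hδ)
    have hlt := hδ.1
    have hnδ : 0 ≤ ((n : ℝ) - 4) * (δ - δ₀) := mul_nonneg (by linarith) (by linarith)
    rcases le_total (π / 3 + (n + 5 / 2) * δ) π with hle | hle
    · rw [← hF₀, hF, hF]
      have c₁ : cos (π / 3 + (n + 5 / 2) * δ) < cos (π / 3 + (n + 5 / 2) * δ₀) :=
        cos_lt_cos_of_nonneg_of_le_pi (by linarith) (by linarith) (by linarith)
      have c₂ : cos (π / 3 + (n - 1 / 2) * δ) < cos (π / 3 + (n - 1 / 2) * δ₀) :=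
        cos_lt_cos_of_nonneg_of_le_pi (by linarith) (by linarith) (by linarith)
      have c₃ : cos ((n + 1 / 2) * δ) < cos ((n + 1 / 2) * δ₀) :=
        cos_lt_cos_of_nonneg_of_le_pi (by linarith) (by linarith) (by linarith)
      linarith
    · have c₁ : cos (π / 3 + (n + 5 / 2) * δ) < 0 :=
        cos_neg_of_pi_div_two_lt_of_lt (by linarith) (by linarith)
      have c₂ : cos (π / 6 + n * δ) < 0 :=
        cos_neg_of_pi_div_two_lt_of_lt (by linarith) (by linarith)
      have c₃ : 0 < cos (π / 6 - δ / 2) := cos_pos_of_mem_Ioo ⟨by linarith, by linarith⟩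
      have e₁ : π / 3 + ((n : ℝ) - 1 / 2) * δ = π / 6 + n * δ + (π / 6 - δ / 2) := by ring
      have e₂ : ((n : ℝ) + 1 / 2) * δ = π / 6 + n * δ - (π / 6 - δ / 2) := by ring
      rw [hF, e₁, e₂, cos_add (π / 6 + n * δ), cos_sub (π / 6 + n * δ)]
      linarith [mul_neg_of_neg_of_pos c₂ c₃]

/-- Signs on the interval for `n ≡ 2 (mod 3)`. -/
theorem signs_of_mod_three_eq_two {n : ℕ} (hn : 5 ≤ n) (h3 : n % 3 = 2) {δ₀ β : ℝ}
    (h₀ : -(π / (2 * n + 5)) ≤ δ₀) (hβ : β ≤ -(π / (6 * n + 3)))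
    (hF₀ : FN n (2 * π / 3 + δ₀) = 0) :
    (∀ δ ∈ Set.Icc δ₀ β, 0 < sin (((n : ℝ) - 1) * (2 * π / 3 + δ)) ∧
      sin (((n : ℝ) - 2) * (2 * π / 3 + δ)) ≤ 0) ∧
    ∀ δ ∈ Set.Ioc δ₀ β, FN n (2 * π / 3 + δ) < 0 := by
  have hπ := pi_pos
  have hn' : (5 : ℝ) ≤ n := by exact_mod_cast hn
  obtain ⟨k, hk⟩ : ∃ k : ℕ, (n : ℝ) = 3 * k + 2 := ⟨n / 3, by exact_mod_cast (by omega)⟩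
  have bounds : ∀ δ ∈ Set.Icc δ₀ β, -π ≤ 2 * (n * δ) + 5 * δ ∧ δ < 0 ∧ n * δ ≤ 5 * δ := by
    rintro δ ⟨hδ₀, hδ₁⟩
    have h₁ : -(π / (2 * n + 5)) ≤ δ := h₀.trans hδ₀
    have h₂ : 0 < π / (6 * n + 3) := by positivity
    have h₃ : δ < 0 := by linarith
    rw [← neg_div, div_le_iff₀ (by positivity)] at h₁
    exact ⟨by linarith, h₃, mul_le_mul_of_nonpos_right hn' h₃.le⟩
  have hF : ∀ δ, FN n (2 * π / 3 + δ) = -cos (-((n + 5 / 2) * δ))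
      - cos (-((n - 1 / 2) * δ)) - cos (π / 3 - (n + 1 / 2) * δ) := by
    intro δ
    have e₁ : ((n : ℝ) + 5 / 2) * (2 * π / 3 + δ)
        = (n + 5 / 2) * δ + π + (k + 1 : ℕ) * (2 * π) := by
      push_cast; linear_combination 2 * π / 3 * hk
    have e₂ : ((n : ℝ) - 1 / 2) * (2 * π / 3 + δ)
        = (n - 1 / 2) * δ + π + k * (2 * π) := by
      linear_combination 2 * π / 3 * hk
    have e₃ : ((n : ℝ) + 1 / 2) * (2 * π / 3 + δ)
        = -(π / 3 - (n + 1 / 2) * δ) + (k + 1 : ℕ) * (2 * π) := by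
      push_cast; linear_combination 2 * π / 3 * hk
    rw [FN_eq_add_sub, e₁, e₂, e₃]
    simp only [cos_add_nat_mul_two_pi, cos_add_pi, cos_neg]
    ring
  refine ⟨fun δ hδ => ?_, fun δ hδ => ?_⟩
  · obtain ⟨b₁, b₂, b₃⟩ := bounds δ hδ
    have e₁ : ((n : ℝ) - 1) * (2 * π / 3 + δ) = 2 * π / 3 + (n - 1) * δ + k * (2 * π) := by
      linear_combination 2 * π / 3 * hk
    have e₂ : ((n : ℝ) - 2) * (2 * π / 3 + δ) = -(-((n - 2) * δ)) + k * (2 * π) := by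
      linear_combination 2 * π / 3 * hk
    rw [e₁, e₂, sin_add_nat_mul_two_pi, sin_add_nat_mul_two_pi, sin_neg, neg_nonpos]
    exact ⟨sin_pos_of_pos_of_lt_pi (by linarith) (by linarith),
      sin_nonneg_of_nonneg_of_le_pi (by linarith) (by linarith)⟩
  · obtain ⟨a₁, a₂, a₃⟩ := bounds δ₀ ⟨le_rfl, (hδ.1.trans_le hδ.2).le⟩
    obtain ⟨b₁, b₂, b₃⟩ := bounds δ (Set.Ioc_subset_Icc_self hδ)
    have hlt := hδ.1
    have hnδ : 0 ≤ ((n : ℝ) - 5) * (δ - δ₀) := mul_nonneg (by linarith) (by linarith)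
    rw [← hF₀, hF, hF]
    have c₁ : cos (-((n + 5 / 2) * δ₀)) < cos (-((n + 5 / 2) * δ)) :=
      cos_lt_cos_of_nonneg_of_le_pi (by linarith) (by linarith) (by linarith)
    have c₂ : cos (-((n - 1 / 2) * δ₀)) < cos (-((n - 1 / 2) * δ)) :=
      cos_lt_cos_of_nonneg_of_le_pi (by linarith) (by linarith) (by linarith)
    have c₃ : cos (π / 3 - (n + 1 / 2) * δ₀) < cos (π / 3 - (n + 1 / 2) * δ) :=
      cos_lt_cos_of_nonneg_of_le_pi (by linarith) (by linarith) (by linarith)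
    linarith

/-- Proposition `s`. Let `S k` be the Chebyshev polynomials of the
second kind (`S 0 y = 1`, `S 1 y = y`, `S k y = y * S (k-1) y - S (k-2) y` for all
integers `k`). Let `n ≥ 3` and `θ_n ∈ [α_n, γ_n)` with `F(θ_n) = 0`. For either choice
of sign `ε = ±1`, with `y = 2 cos θ` and `s = x_ε² + y² + z_ε² - x_ε y z_ε - 4`:
`s > 0` for every `θ ∈ (θ_n, β_n]`, and `s = 0` at `θ = θ_n`. -/
theorem s_positive
    (S : ℤ → ℝ → ℝ)
    (hS0 : ∀ y : ℝ, S 0 y = 1)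
    (hS1 : ∀ y : ℝ, S 1 y = y)
    (hSrec : ∀ (k : ℤ) (y : ℝ), S k y = y * S (k - 1) y - S (k - 2) y)
    (n : ℕ) (hn : 3 ≤ n)
    (θn : ℝ) (hθn : θn ∈ Set.Ico (alphaN n) (gammaN n)) (hFθn : FN n θn = 0)
    (ε : ℝ) (hε : ε = 1 ∨ ε = -1) :
    (∀ θ ∈ Set.Ioc θn (betaN n),
      0 < xD S n ε (2 * Real.cos θ) ^ 2 + (2 * Real.cos θ) ^ 2
          + zD S n ε (2 * Real.cos θ) ^ 2
          - xD S n ε (2 * Real.cos θ) * (2 * Real.cos θ) * zD S n ε (2 * Real.cos θ)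
          - 4) ∧
    (xD S n ε (2 * Real.cos θn) ^ 2 + (2 * Real.cos θn) ^ 2
        + zD S n ε (2 * Real.cos θn) ^ 2
        - xD S n ε (2 * Real.cos θn) * (2 * Real.cos θn) * zD S n ε (2 * Real.cos θn)
        - 4 = 0) := by
  have hπ := pi_pos
  have hn' : (3 : ℝ) ≤ n := by exact_mod_cast hn
  obtain ⟨hα, hγ⟩ := hθn
  have hF₀ : FN n (2 * π / 3 + (θn - 2 * π / 3)) = 0 := by rwa [add_sub_cancel]
  have d₁ : 0 < π / (6 * n + 3) := by positivity
  rcases (by omega : n % 3 = 0 ∨ n % 3 = 1 ∨ n % 3 = 2) with h3 | h3 | h3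
  · simp only [alphaN, betaN, gammaN, h3, if_true] at hα hγ ⊢
    have d₂ : π / (6 * n + 15) ≤ π / 33 := by gcongr; linarith
    have d₃ : π / (6 * n + 3) ≤ π / 21 := by gcongr; linarith
    obtain ⟨hab, hF⟩ := signs_of_mod_three_eq_zero hn h3 (δ₀ := θn - 2 * π / 3)
      (by linarith) (add_sub_cancel_left (2 * π / 3) (π / (6 * n + 3))).le hF₀
    refine s_sign_of_interval hS0 hS1 hSrec hn hε (Or.inl ⟨h3, rfl⟩) (by linarith) hFθn
      (by linarith) (by linarith) (by linarith) (fun δ hδ => ?_) (fun δ hδ => ?_)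
    · obtain ⟨ha, hb⟩ := hab δ hδ
      constructor <;> linarith
    · linarith [hF δ hδ]
  · simp only [alphaN, betaN, gammaN, h3, one_ne_zero, if_true, if_false] at hα hγ ⊢
    have hn4 : 4 ≤ n := by omega
    have hn4' : (4 : ℝ) ≤ n := by exact_mod_cast hn4
    have d₂ : 0 < π / (6 * n - 3) := div_pos hπ (by linarith)
    have d₃ : 4 * π / (12 * n + 9) ≤ 4 * π / 57 := by gcongr; linarith
    have d₄ : 4 * π / (12 * n + 9) ≤ π / (2 * n + 1) := by
      rw [div_le_div_iff₀ (by positivity) (by positivity)]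
      nlinarith
    have d₅ : π / (2 * n + 1) ≤ π / 9 := by gcongr; linarith
    obtain ⟨hab, hF⟩ := signs_of_mod_three_eq_one hn4 h3 (δ₀ := θn - 2 * π / 3)
      (by linarith) (add_sub_cancel_left (2 * π / 3) (π / (2 * n + 1))).le hF₀
    exact s_sign_of_interval hS0 hS1 hSrec hn hε (Or.inr ⟨by omega, rfl⟩) (by linarith) hFθn
      (by linarith) (by linarith) (by linarith) (by simpa only [one_mul] using hab)
      (by simpa only [one_mul] using hF)
  · simp only [alphaN, betaN, gammaN, h3, OfNat.ofNat_ne_zero, OfNat.ofNat_ne_one, if_false]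
      at hα hγ ⊢
    have hn5 : 5 ≤ n := by omega
    have hn5' : (5 : ℝ) ≤ n := by exact_mod_cast hn5
    have d₂ : π / (2 * n + 5) ≤ π / 15 := by gcongr; linarith
    have d₃ : π / (6 * n + 3) ≤ 4 * π / (12 * n + 9) := by
      rw [div_le_div_iff₀ (by positivity) (by positivity)]
      nlinarith
    obtain ⟨hab, hF⟩ := signs_of_mod_three_eq_two hn5 h3 (δ₀ := θn - 2 * π / 3)
      (β := 2 * π / 3 - π / (6 * n + 3) - 2 * π / 3) (by linarith) (by linarith) hF₀
    exact s_sign_of_interval hS0 hS1 hSrec hn hε (Or.inr ⟨by omega, rfl⟩) (by linarith) hFθn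
      (by linarith) (by linarith) (by linarith) (by simpa only [one_mul] using hab)
      (by simpa only [one_mul] using hF)
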